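/- If G is a finite simple group with U(G) = U(PSL(2,11)) = {1, 55, 120, 220, 264}, then G ≅ PSL(2,11). -/

import Mathlib

open scoped MatrixGroups

/-- The size of the conjugacy class of `x`. -/
noncomputable def classSize {G : Type*} [Group G] (x : G) : ℕ :=
  Nat.card {y : G // IsConj x y}

/-- `u_G(n)`: the number of elements of `G` whose conjugacy class has size `n`. -/
noncomputable def sameSizeCount (G : Type*) [Group G] (n : ℕ) : ℕ :=
  Nat.card {x : G // classSize x = n}

/-- `U(G)`: the same-size conjugacy class set of `G`. -/
def sameSizeSet (G : Type*) [Group G] : Set ℕ :=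
  {m | ∃ x : G, m = sameSizeCount G (classSize x)}

instance : Fact (Nat.Prime 11) := ⟨by norm_num⟩

theorem numLem (S : Finset ℕ) (u : ℕ → ℕ) (N : ℕ) (hsum : N = ∑ n ∈ S, u n)
  (hval : ∀ n ∈ S, u n = 1 ∨ u n = 55 ∨ u n = 120 ∨ u n = 220 ∨ u n = 264)
  (hdvd : ∀ n ∈ S, n ∣ u n) (hN : ∀ n ∈ S, n ∣ N) (hfac : ∀ n ∈ S, n ≠ 1 → N ∣ n.factorial)
  (h1 : ∃ n ∈ S, u n = 1) (h55 : ∃ n ∈ S, u n = 55) (h120 : ∃ n ∈ S, u n = 120)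
  (h220 : ∃ n ∈ S, u n = 220) (h264 : ∃ n ∈ S, u n = 264) :
  11 ∣ N ∧ ¬ 121 ∣ N ∧ 660 ≤ N := by
  have key : ∀ v, ∑ n ∈ S with u n = v, u n = v * (S.filter (fun n => u n = v)).card := by
    intro v
    rw [Finset.sum_congr rfl (g := fun _ => v) (by simp), Finset.sum_const, smul_eq_mul, mul_comm]
  have hS : N = ∑ v ∈ ({1, 55, 120, 220, 264} : Finset ℕ), v * (S.filter (fun n => u n = v)).card := by
    rw [hsum, ← Finset.sum_fiberwise_of_maps_to (s := S) (t := {1, 55, 120, 220, 264}) (g := u)]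
    · exact Finset.sum_congr rfl (fun v _ => key v)
    · intro n hn; simpa using hval n hn
  rw [Finset.sum_insert (by decide), Finset.sum_insert (by decide), Finset.sum_insert (by decide),
    Finset.sum_insert (by decide), Finset.sum_singleton] at hS
  have pos : ∀ v, (∃ n ∈ S, u n = v) → 1 ≤ (S.filter (fun n => u n = v)).card := by
    rintro v ⟨n, hn, hv⟩
    exact Finset.card_pos.2 ⟨n, by simp [hn, hv]⟩
  have p55 := pos 55 h55
  have p120 := pos 120 h120
  have p220 := pos 220 h220
  have p264 := pos 264 h264
  have p1 := pos 1 h1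
  have bd : ∀ v (T : Finset ℕ), (∀ n ∈ S, u n = v → n ∈ T) → (S.filter (fun n => u n = v)).card ≤ T.card := by
    intro v T h
    apply Finset.card_le_card
    intro n hn
    simp only [Finset.mem_filter] at hn
    exact h n hn.1 hn.2
  have q1 := bd 1 {1} (by
    intro n hn hv
    have := hdvd n hn
    rw [hv] at this
    simpa using this)
  simp only [Finset.card_singleton] at q1
  have hge : 660 ≤ N := by omega
  have u1 : u 1 = 1 := by
    obtain ⟨n, hn, hv⟩ := h1
    have := hdvd n hn
    rw [hv] at this
    rw [Nat.dvd_one.1 this] at hv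
    exact hv
  have h11 : 11 ∣ N := by
    obtain ⟨n, hn, hv⟩ := h55
    have h := hdvd n hn
    have hf := hfac n hn
    have hNn := hN n hn
    rw [hv] at h
    have : n ∈ Nat.divisors 55 := by simp [h]
    have e : Nat.divisors 55 = {1, 5, 11, 55} := by decide
    rw [e] at this
    simp only [Finset.mem_insert, Finset.mem_singleton] at this
    rcases this with rfl | rfl | rfl | rfl
    · omega
    · have := Nat.le_of_dvd (by decide) (hf (by decide))
      have e : Nat.factorial 5 = 120 := rfl
      omega
    · exact hNn
    · exact dvd_trans (by decide) hNn
  refine ⟨h11, ?_, hge⟩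
  have ge11 : ∀ n ∈ S, n ≠ 1 → 11 ≤ n := by
    intro n hn h
    exact (Nat.Prime.dvd_factorial (by norm_num)).1 (h11.trans (hfac n hn h))
  by_cases hm : 11 ∈ S
  · intro h
    have := h.trans (hfac 11 hm (by decide))
    revert this
    decide
  have mem : ∀ v, v ≠ 0 → v ≠ 1 → ∀ n ∈ S, u n = v → n ∈ (Nat.divisors v).filter (fun n => 11 < n) := by
    intro v h0 hv1 n hn hv
    have hne : n ≠ 1 := by rintro rfl; omega
    have := ge11 n hn hne
    have h2 : n ≠ 11 := by rintro rfl; exact hm hn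
    have h3 := hdvd n hn
    rw [hv] at h3
    simp only [Finset.mem_filter, Nat.mem_divisors]
    exact ⟨⟨h3, h0⟩, by omega⟩
  have q55 := bd 55 _ (mem 55 (by decide) (by decide))
  have q120 := bd 120 _ (mem 120 (by decide) (by decide))
  have q220 := bd 220 _ (mem 220 (by decide) (by decide))
  have q264 := bd 264 _ (mem 264 (by decide) (by decide))
  have c55 : ((Nat.divisors 55).filter (fun n => 11 < n)).card = 1 := by decide
  have c120 : ((Nat.divisors 120).filter (fun n => 11 < n)).card = 8 := by decide +kernel
  have c220 : ((Nat.divisors 220).filter (fun n => 11 < n)).card = 5 + 1 := by decide +kernel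
  have c264 : ((Nat.divisors 264).filter (fun n => 11 < n)).card = 9 := by decide +kernel
  have d55 : 55 ∈ S := by
    obtain ⟨n, hn, hv⟩ := h55
    have h := mem 55 (by decide) (by decide) n hn hv
    have e : (Nat.divisors 55).filter (fun n => 11 < n) = {55} := by decide
    rw [e, Finset.mem_singleton] at h
    rwa [h] at hn
  have h5 : 5 ∣ N := dvd_trans (by decide) (hN 55 d55)
  intro h121
  have hb1 : (S.filter (fun n => u n = 120)).card = 1 := by
    rw [c120] at q120
    clear q220 q264 q55
    omega
  have ha1 : (S.filter (fun n => u n = 55)).card = 1 := by omega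
  have h11' : (S.filter (fun n => u n = 1)).card = 1 := by omega
  rw [hb1, ha1, h11'] at hS
  rw [c220] at q220
  rw [c264] at q264
  clear p120 p55 p1 q1 c55 c120 c220 c264 q55 q120
  by_cases hb : N = 2420
  · have q := bd 264 {22, 44} (by
      intro n hn hv
      have h := mem 264 (by decide) (by decide) n hn hv
      simp only [Finset.mem_filter, Nat.mem_divisors] at h
      have h2 := Nat.dvd_gcd h.1.1 (hb ▸ hN n hn)
      have : n ∈ (Nat.divisors 44).filter (fun n => 11 < n) := by
        simp only [Finset.mem_filter, Nat.mem_divisors]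
        exact ⟨⟨by rwa [show Nat.gcd 264 2420 = 44 by norm_num] at h2, by decide⟩, h.2⟩
      have e : (Nat.divisors 44).filter (fun n => 11 < n) = {22, 44} := by decide
      rwa [e] at this)
    have : ({22, 44} : Finset ℕ).card = 2 := rfl
    omega
  · clear hb1 ha1 h11' pos bd mem key hge
    generalize (S.filter (fun n => u n = 220)).card = c at *
    generalize (S.filter (fun n => u n = 264)).card = d at *
    clear hsum hval hdvd hN hfac h1 h55 h120 h220 h264 u1 ge11 hm d55
    interval_cases d <;> omega

theorem classSize_congr {G : Type*} [Group G] {x y : G} (h : IsConj x y) : classSize x = classSize y := by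
  unfold classSize
  have : ∀ z, IsConj x z ↔ IsConj y z := fun z => ⟨fun h2 => h.symm.trans h2, fun h2 => h.trans h2⟩
  simp only [this]

theorem classSize_eq_index {G : Type*} [Group G] [Finite G] (x : G) :
    classSize x = (Subgroup.centralizer {x}).index := by
  have h2 : classSize x = Nat.card (MulAction.orbit (ConjAct G) x) := by
    unfold classSize
    apply Nat.card_congr
    apply Equiv.subtypeEquivRight
    intro y
    rw [ConjAct.mem_orbit_conjAct]
    exact isConj_comm
  have h3 := Subgroup.index_mul_card (MulAction.stabilizer (ConjAct G) x)
  have h4 := Subgroup.index_mul_card (Subgroup.centralizer {x})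
  rw [Subgroup.nat_card_centralizer_nat_card_stabilizer] at h4
  rw [MulAction.index_stabilizer, ← Nat.card_coe_set_eq, ← h2] at h3
  have h5 : Nat.card (ConjAct G) = Nat.card G := Nat.card_congr ConjAct.ofConjAct.toEquiv
  have : Finite (ConjAct G) := Finite.of_equiv G ConjAct.toConjAct.toEquiv
  exact Nat.eq_of_mul_eq_mul_right Nat.card_pos (h3.trans (h5.trans h4.symm))

theorem dvd_sameSizeCount {G : Type*} [Group G] [Finite G] (n : ℕ) : n ∣ sameSizeCount G n := by
  classical
  have := Fintype.ofFinite G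
  unfold sameSizeCount
  rw [Nat.card_eq_fintype_card, Fintype.card_subtype]
  rw [Finset.card_eq_sum_card_image (ConjClasses.mk (α := G))]
  apply Finset.dvd_sum
  intro c hc
  simp only [Finset.mem_image, Finset.mem_filter, Finset.mem_univ, true_and] at hc
  obtain ⟨x, hx, rfl⟩ := hc
  apply dvd_of_eq
  conv_lhs => rw [← hx]
  unfold classSize
  rw [Nat.card_eq_fintype_card, Fintype.card_subtype]
  congr 1
  ext y
  simp only [Finset.mem_filter, Finset.mem_univ, true_and, ConjClasses.mk_eq_mk_iff_isConj]
  constructor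
  · intro h
    exact ⟨(classSize_congr h).symm.trans hx, h.symm⟩
  · intro h
    exact h.2.symm

theorem card_dvd_factorial_index {G : Type*} [Group G] [Finite G] [IsSimpleGroup G] (H : Subgroup G)
    (hH : H ≠ ⊤) : Nat.card G ∣ H.index.factorial := by
  have h := Subgroup.normalCore_eq_ker H
  have hb : (MulAction.toPermHom G (G ⧸ H)).ker = ⊥ := by
    rcases (inferInstance : H.normalCore.Normal).eq_bot_or_eq_top with h2 | h2
    · rw [← h, h2]
    · exfalso; apply hH; rw [eq_top_iff, ← h2]; exact H.normalCore_le
  have hinj := (MonoidHom.ker_eq_bot_iff _).1 hb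
  have := Subgroup.card_dvd_of_injective _ hinj
  rwa [Nat.card_perm] at this

theorem sum_sameSize {G : Type*} [Group G] [Fintype G] [DecidableEq G] :
    Nat.card G = ∑ n ∈ Finset.univ.image (classSize (G := G)), sameSizeCount G n := by
  rw [Nat.card_eq_fintype_card, ← Finset.card_univ, Finset.card_eq_sum_card_image (classSize (G := G))]
  apply Finset.sum_congr rfl
  intro n hn
  unfold sameSizeCount
  rw [Nat.card_eq_fintype_card, Fintype.card_subtype]

theorem card_facts {G : Type*} [Group G] [Finite G] [IsSimpleGroup G]
    (hU : sameSizeSet G = {1, 55, 120, 220, 264}) :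
    (11 ∣ Nat.card G ∧ ¬ 121 ∣ Nat.card G ∧ 660 ≤ Nat.card G) ∧
    ∀ x : G, Nat.Coprime (classSize x) 11 → classSize x ∣ 120 := by
  classical
  have := Fintype.ofFinite G
  have hv : ∀ x : G, sameSizeCount G (classSize x) = 1 ∨ sameSizeCount G (classSize x) = 55 ∨
      sameSizeCount G (classSize x) = 120 ∨ sameSizeCount G (classSize x) = 220 ∨
      sameSizeCount G (classSize x) = 264 := by
    intro x
    have : sameSizeCount G (classSize x) ∈ sameSizeSet G := ⟨x, rfl⟩
    rw [hU] at this
    simpa using this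
  have hex : ∀ v, v ∈ ({1, 55, 120, 220, 264} : Set ℕ) →
      ∃ n ∈ Finset.univ.image (classSize (G := G)), sameSizeCount G n = v := by
    intro v h
    rw [← hU] at h
    obtain ⟨x, hx⟩ := h
    exact ⟨classSize x, by simp, hx.symm⟩
  constructor
  · apply numLem (Finset.univ.image (classSize (G := G))) (sameSizeCount G) _ sum_sameSize
    · intro n hn
      simp only [Finset.mem_image, Finset.mem_univ, true_and] at hn
      obtain ⟨x, rfl⟩ := hn
      exact hv x
    · intro n _
      exact dvd_sameSizeCount n
    · intro n hn
      simp only [Finset.mem_image, Finset.mem_univ, true_and] at hn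
      obtain ⟨x, rfl⟩ := hn
      rw [classSize_eq_index]
      exact Subgroup.index_dvd_card _
    · intro n hn h1
      simp only [Finset.mem_image, Finset.mem_univ, true_and] at hn
      obtain ⟨x, rfl⟩ := hn
      rw [classSize_eq_index] at h1 ⊢
      exact card_dvd_factorial_index _ (fun h => h1 (by rw [h, Subgroup.index_top]))
    all_goals exact hex _ (by simp)
  · intro x hx
    have h := dvd_sameSizeCount (G := G) (classSize x)
    rcases hv x with h2 | h2 | h2 | h2 | h2 <;> rw [h2] at h
    · exact h.trans (by decide)
    · exact (Nat.Coprime.dvd_of_dvd_mul_left (m := 11) (n := 5) hx h).trans (by decide)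
    · exact h
    · exact (Nat.Coprime.dvd_of_dvd_mul_left (m := 11) (n := 20) hx h).trans (by decide)
    · exact (Nat.Coprime.dvd_of_dvd_mul_left (m := 11) (n := 24) hx h).trans (by decide)

theorem sylow_twelve {G : Type*} [Group G] [Finite G] [IsSimpleGroup G]
    (h11 : 11 ∣ Nat.card G) (h121 : ¬ 121 ∣ Nat.card G) (h660 : 660 ≤ Nat.card G)
    (hc : ∀ x : G, Nat.Coprime (classSize x) 11 → classSize x ∣ 120) (P : Sylow 11 G) :
    Nat.card (Sylow 11 G) = 12 ∧ ∃ σ : G, orderOf σ = 11 ∧ Subgroup.zpowers σ = (P : Subgroup G) := by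
  have hP : Nat.card P = 11 := by
    rw [Sylow.card_eq_multiplicity]
    have : (Nat.card G).factorization 11 = 1 := by
      have h0 : Nat.card G ≠ 0 := by omega
      have a1 : 1 ≤ (Nat.card G).factorization 11 :=
        (Nat.Prime.dvd_iff_one_le_factorization (by norm_num) h0).1 h11
      have a2 : ¬ 2 ≤ (Nat.card G).factorization 11 := by
        intro h
        exact h121 (((by norm_num : Nat.Prime 11).pow_dvd_iff_le_factorization h0).2 h)
      omega
    rw [this, pow_one]
  have hcyc : IsCyclic P := isCyclic_of_prime_card hP
  obtain ⟨s, hs⟩ := hcyc.exists_generator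
  have hz : Subgroup.zpowers (s : G) = (P : Subgroup G) := by
    ext x
    constructor
    · intro hx
      exact (Subgroup.zpowers_le.2 s.2) hx
    · intro hx
      obtain ⟨k, hk⟩ := hs ⟨x, hx⟩
      exact ⟨k, by simpa using congrArg Subtype.val hk⟩
  have ho : orderOf (s : G) = 11 := by
    rw [← Nat.card_zpowers, hz]; exact hP
  refine ⟨?_, s, ho, hz⟩
  have hPC : (P : Subgroup G) ≤ Subgroup.centralizer {(s : G)} := by
    refine hz.ge.trans ?_
    rw [Subgroup.zpowers_le, Subgroup.mem_centralizer_singleton_iff]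
  have hCN : Subgroup.centralizer {(s : G)} ≤ Subgroup.normalizer (P : Set G) := by
    intro g hg
    rw [Subgroup.mem_centralizer_singleton_iff] at hg
    have : g ∈ Subgroup.centralizer (P : Set G) := by
      rw [Subgroup.mem_centralizer_iff]
      intro x hx
      have hx' : x ∈ Subgroup.zpowers (s : G) := by rw [hz]; exact hx
      obtain ⟨k, rfl⟩ := hx'
      have hcm : Commute g (s : G) := hg
      exact (hcm.zpow_right k).symm.eq
    exact Subgroup.centralizer_le_normalizer _ this
  have hcop : Nat.Coprime (classSize (s : G)) 11 := by
    rw [classSize_eq_index, Nat.coprime_comm, Nat.Prime.coprime_iff_not_dvd (by norm_num)]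
    intro h
    exact P.not_dvd_index (h.trans (Subgroup.index_dvd_of_le hPC))
  have hd := hc _ hcop
  rw [classSize_eq_index] at hd
  have hn : Nat.card (Sylow 11 G) ∣ 120 := by
    rw [P.card_eq_index_normalizer]
    exact (Subgroup.index_dvd_of_le hCN).trans hd
  have hm := card_sylow_modEq_one 11 G
  have hne : Nat.card (Sylow 11 G) ≠ 1 := by
    intro h
    rw [P.card_eq_index_normalizer, Subgroup.index_eq_one] at h
    have hN : (P : Subgroup G).Normal := Subgroup.normalizer_eq_top_iff.1 h
    rcases hN.eq_bot_or_eq_top with h2 | h2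
    · have : Nat.card (P : Subgroup G) = 11 := hP
      rw [h2, Subgroup.card_bot] at this
      omega
    · have : Nat.card (P : Subgroup G) = 11 := hP
      rw [h2, Subgroup.card_top] at this
      omega
  generalize Nat.card (Sylow 11 G) = n at *
  have hle := Nat.le_of_dvd (by norm_num) hn
  unfold Nat.ModEq at hm
  have : n ∈ (Nat.divisors 120).filter (fun n => n % 11 = 1) := by
    simp [hn]; omega
  have e : (Nat.divisors 120).filter (fun n => n % 11 = 1) = {1, 12} := by decide +kernel
  rw [e] at this
  simp at this
  omega

abbrev Om := OnePoint (ZMod 11)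

theorem embed {G : Type*} [Group G] [Finite G] [IsSimpleGroup G] (P : Sylow 11 G)
    (h12 : Nat.card (Sylow 11 G) = 12) (σ : G) (ho : orderOf σ = 11)
    (hz : Subgroup.zpowers σ = (P : Subgroup G)) :
    ∃ φ : G →* Equiv.Perm Om, Function.Injective φ ∧ (∀ y, ∃ g, φ g OnePoint.infty = y) ∧
      (∀ b : ZMod 11, ∃ g, φ g OnePoint.infty = OnePoint.infty ∧ 
        ∀ x : ZMod 11, φ g (x : Om) = ((x + b : ZMod 11) : Om)) ∧
      (∀ g, φ g OnePoint.infty = OnePoint.infty → ∃ k b : ZMod 11, k ≠ 0 ∧ 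
        ∀ x : ZMod 11, φ g (x : Om) = ((k * x + b : ZMod 11) : Om)) := by
  classical
  have : Finite (Sylow 11 G) := Nat.finite_of_card_ne_zero (by omega)
  obtain ⟨Q, hQ⟩ : ∃ Q : Sylow 11 G, Q ≠ P := by
    have : Nontrivial (Sylow 11 G) := Finite.one_lt_card_iff_nontrivial.1 (by omega)
    exact exists_ne P
  let τ : ZMod 11 → G := fun i => σ ^ i.val
  have τn : ∀ n : ℕ, σ ^ n = τ n := by
    intro n
    simp only [τ]
    rw [pow_eq_pow_iff_modEq, ho, ZMod.val_natCast]
    exact (Nat.mod_modEq n 11).symm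
  have τadd : ∀ a b, τ (a + b) = τ a * τ b := by
    intro a b
    have := τn (a.val + b.val)
    rw [pow_add] at this
    simp only [Nat.cast_add, ZMod.natCast_val, ZMod.cast_id', id] at this
    exact this.symm
  have τmul : ∀ a b, τ (a * b) = τ a ^ b.val := by
    intro a b
    have := τn (a.val * b.val)
    rw [pow_mul] at this
    simp only [Nat.cast_mul, ZMod.natCast_val, ZMod.cast_id', id] at this
    exact this.symm
  have τ0 : τ 0 = 1 := by simp [τ]
  have τ1 : τ 1 = σ := by
    have := τn 1
    simpa using this.symm
  have τP : ∀ i, τ i ∈ P := by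
    intro i
    have : τ i ∈ (P : Subgroup G) := by
      rw [← hz]; exact Subgroup.npow_mem_zpowers σ _
    exact this
  have Pτ : ∀ g ∈ P, ∃ i, g = τ i := by
    intro g hg
    have hg' : g ∈ Subgroup.zpowers σ := by rw [hz]; exact hg
    have hfin : IsOfFinOrder σ := isOfFinOrder_of_finite σ
    rw [← hfin.mem_powers_iff_mem_zpowers] at hg'
    obtain ⟨n, rfl⟩ := hg'
    exact ⟨n, τn n⟩
  have fixP : ∀ g ∈ P, g • P = P := by
    intro g hg
    rw [Sylow.smul_eq_iff_mem_normalizer]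
    exact Subgroup.le_normalizer hg
  have nfix : ∀ i, i ≠ 0 → τ i • Q ≠ Q := by
    intro i hi h
    have hσ : σ ∈ Subgroup.normalizer (Q : Set G) := by
      rw [← τ1, ← mul_inv_cancel₀ hi, τmul]
      rw [Sylow.smul_eq_iff_mem_normalizer] at h
      exact Subgroup.pow_mem _ h _
    have hle : (P : Subgroup G) ≤ Subgroup.normalizer (Q : Set G) := by
      rw [← hz, Subgroup.zpowers_le]; exact hσ
    have h3 := P.2.inf_normalizer_sylow Q
    have h4 : (P : Subgroup G) ≤ Q := by
      rw [← inf_eq_left, ← h3, inf_eq_left]; exact hle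
    exact hQ (Sylow.ext (P.3 Q.2 h4))
  let e0 : Om → Sylow 11 G := fun o => @OnePoint.rec (ZMod 11) (fun _ => Sylow 11 G) P (fun i => τ i • Q) o
  have e0i : e0 OnePoint.infty = P := rfl
  have e0c : ∀ i : ZMod 11, e0 (i : Om) = τ i • Q := fun i => rfl
  have neP : ∀ i, τ i • Q ≠ P := by
    intro i h
    apply hQ
    have := fixP _ (τP i)
    exact smul_left_cancel (τ i) (h.trans this.symm)
  have inj0 : Function.Injective e0 := by
    intro x y hxy
    induction x using OnePoint.rec with
    | infty =>
      induction y using OnePoint.rec with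
      | infty => rfl
      | coe j => exact absurd hxy.symm (neP j)
    | coe i =>
      induction y using OnePoint.rec with
      | infty => exact absurd hxy (neP i)
      | coe j =>
        rw [e0c, e0c] at hxy
        by_contra hne
        have hij : i - j ≠ 0 := by
          intro h
          exact hne (by rw [sub_eq_zero.1 h])
        apply nfix _ hij
        have : τ i = τ j * τ (i - j) := by rw [← τadd]; congr 1; ring
        rw [this, mul_smul] at hxy
        exact smul_left_cancel (τ j) hxy
  have bij : Function.Bijective e0 := by
    rw [Nat.bijective_iff_injective_and_card]
    refine ⟨inj0, ?_⟩
    rw [h12]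
    have : Nat.card Om = Nat.card (Option (ZMod 11)) := rfl
    rw [this, Finite.card_option]
    simp
  let e : Om ≃ Sylow 11 G := Equiv.ofBijective e0 bij
  let φ : G →* Equiv.Perm Om := (e.symm.permCongrHom.toMonoidHom).comp (MulAction.toPermHom G (Sylow 11 G))
  have hφ : ∀ g x, e0 (φ g x) = g • e0 x := by
    intro g x
    change e (e.symm (g • e x)) = _
    rw [Equiv.apply_symm_apply]
    rfl
  have htrans : ∀ y, ∃ g, φ g OnePoint.infty = y := by
    intro y
    obtain ⟨g, hg⟩ := MulAction.exists_smul_eq G P (e0 y)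
    refine ⟨g, inj0 ?_⟩
    rw [hφ, e0i, hg]
  refine ⟨φ, ?_, htrans, ?_, ?_⟩
  · rw [← MonoidHom.ker_eq_bot_iff]
    rcases (inferInstance : φ.ker.Normal).eq_bot_or_eq_top with h | h
    · exact h
    · exfalso
      obtain ⟨g, hg⟩ := htrans ((0 : ZMod 11) : Om)
      have : g ∈ φ.ker := by rw [h]; trivial
      rw [MonoidHom.mem_ker] at this
      rw [this] at hg
      exact OnePoint.infty_ne_coe _ hg
  · intro b
    refine ⟨τ b, inj0 ?_, fun x => inj0 ?_⟩
    · rw [hφ, e0i]; exact fixP _ (τP b)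
    · rw [hφ, e0c, e0c, ← mul_smul, ← τadd, add_comm]
  · intro g hg
    have hgP : g • P = P := by rw [← e0i, ← hφ, hg]
    have hgN := Sylow.smul_eq_iff_mem_normalizer.1 hgP
    obtain ⟨k, hk⟩ := Pτ (g * σ * g⁻¹) ((Subgroup.mem_normalizer_iff.1 hgN σ).1 (by rw [← τ1]; exact τP 1))
    obtain ⟨y, hy⟩ := bij.2 (g • Q)
    induction y using OnePoint.rec with
    | infty =>
      exfalso
      rw [e0i] at hy
      exact hQ (smul_left_cancel g (hgP.trans hy).symm)
    | coe b =>
      rw [e0c] at hy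
      refine ⟨k, b, ?_, fun x => inj0 ?_⟩
      · rintro rfl
        rw [τ0, conj_eq_one_iff] at hk
        rw [hk, orderOf_one] at ho
        omega
      · rw [hφ, e0c, e0c, τadd, mul_smul, hy, ← mul_smul, ← mul_smul, τmul, ← hk, conj_pow]
        congr 1
        simp [τ]

theorem aff_ext {p q : Equiv.Perm Om} (hi : p OnePoint.infty = q OnePoint.infty)
    (hc : ∀ x : ZMod 11, p (x : Om) = q (x : Om)) : p = q := by
  ext x
  induction x using OnePoint.rec with
  | infty => exact hi
  | coe x => exact hc x

def multGrp {G : Type*} [Group G] (φ : G →* Equiv.Perm Om) : Subgroup (ZMod 11)ˣ where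
  carrier := {k | ∃ g, φ g OnePoint.infty = OnePoint.infty ∧
    ∀ x : ZMod 11, φ g (x : Om) = (((k : ZMod 11) * x : ZMod 11) : Om)}
  one_mem' := ⟨1, by simp, by simp⟩
  mul_mem' := by
    rintro a b ⟨g, hg, hg'⟩ ⟨h, hh, hh'⟩
    refine ⟨g * h, ?_, ?_⟩
    · rw [map_mul, Equiv.Perm.mul_apply, hh, hg]
    · intro x
      rw [map_mul, Equiv.Perm.mul_apply, hh', hg', Units.val_mul, mul_assoc]
  inv_mem' := by
    rintro a ⟨g, hg, hg'⟩
    refine ⟨g⁻¹, ?_, ?_⟩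
    · rw [map_inv, Equiv.Perm.inv_eq_iff_eq, hg]
    · intro x
      rw [map_inv, Equiv.Perm.inv_eq_iff_eq, hg', Units.mul_inv_cancel_left]

theorem card_stuff {G : Type*} [Group G] [Finite G] [IsSimpleGroup G]
    (φ : G →* Equiv.Perm Om) (hinj : Function.Injective φ)
    (htr : ∀ y, ∃ g, φ g OnePoint.infty = y)
    (hT : ∀ b : ZMod 11, ∃ g, φ g OnePoint.infty = OnePoint.infty ∧
        ∀ x : ZMod 11, φ g (x : Om) = ((x + b : ZMod 11) : Om))
    (hA : ∀ g, φ g OnePoint.infty = OnePoint.infty → ∃ k b : ZMod 11, k ≠ 0 ∧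
        ∀ x : ZMod 11, φ g (x : Om) = ((k * x + b : ZMod 11) : Om)) (h660 : 660 ≤ Nat.card G) :
    Nat.card G = 660 ∧ (∀ k : ZMod 11, k ^ 5 = 1 → ∀ b : ZMod 11, ∃ g, φ g OnePoint.infty = OnePoint.infty ∧
        ∀ x : ZMod 11, φ g (x : Om) = ((k * x + b : ZMod 11) : Om)) ∧
      (∀ g, φ g OnePoint.infty = OnePoint.infty → ∃ k b : ZMod 11, k ^ 5 = 1 ∧
        ∀ x : ZMod 11, φ g (x : Om) = ((k * x + b : ZMod 11) : Om)) := by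
  classical
  let St : Subgroup G := (MulAction.stabilizer (Equiv.Perm Om) (OnePoint.infty : Om)).comap φ
  have memSt : ∀ g, g ∈ St ↔ φ g OnePoint.infty = OnePoint.infty := by
    intro g
    simp [St, MulAction.mem_stabilizer_iff]
  -- index of the stabilizer
  have hidx : St.index = 12 := by
    letI : MulAction G Om := MulAction.compHom Om φ
    have hs : ∀ (g : G) (x : Om), g • x = φ g x := fun g x => rfl
    have hSt : St = MulAction.stabilizer G (OnePoint.infty : Om) := by
      ext g
      rw [memSt, MulAction.mem_stabilizer_iff, hs]
    have horb : MulAction.orbit G (OnePoint.infty : Om) = Set.univ := by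
      rw [Set.eq_univ_iff_forall]
      intro y
      obtain ⟨g, hg⟩ := htr y
      exact ⟨g, hg⟩
    rw [hSt, MulAction.index_stabilizer, horb, Set.ncard_univ]
    have : Nat.card Om = Nat.card (Option (ZMod 11)) := rfl
    rw [this, Finite.card_option]
    simp
  let K := multGrp φ
  have memK : ∀ k : (ZMod 11)ˣ, k ∈ K ↔ ∃ g, φ g OnePoint.infty = OnePoint.infty ∧
    ∀ x : ZMod 11, φ g (x : Om) = (((k : ZMod 11) * x : ZMod 11) : Om) := fun k => Iff.rfl
  choose τ hτi hτ using hT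
  choose m hm using fun k : K => (memK k).1 k.2
  have toK : ∀ g, φ g OnePoint.infty = OnePoint.infty → ∃ k : K, ∃ b : ZMod 11,
      ∀ x : ZMod 11, φ g (x : Om) = ((((k : (ZMod 11)ˣ) : ZMod 11) * x + b : ZMod 11) : Om) := by
    intro g hg
    obtain ⟨k, b, hk, h⟩ := hA g hg
    refine ⟨⟨Units.mk0 k hk, ?_⟩, b, ?_⟩
    · rw [memK]
      refine ⟨(τ (-b)) * g, ?_, ?_⟩
      · rw [map_mul, Equiv.Perm.mul_apply, hg, hτi]
      · intro x
        rw [map_mul, Equiv.Perm.mul_apply, h, hτ]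
        simp
    · intro x
      rw [h]
      simp
  have fromK : ∀ (k : K) (b : ZMod 11), φ (τ b * m k) OnePoint.infty = OnePoint.infty ∧
      ∀ x : ZMod 11, φ (τ b * m k) (x : Om) = ((((k : (ZMod 11)ˣ) : ZMod 11) * x + b : ZMod 11) : Om) := by
    intro k b
    constructor
    · rw [map_mul, Equiv.Perm.mul_apply, (hm k).1, hτi]
    · intro x
      rw [map_mul, Equiv.Perm.mul_apply, (hm k).2, hτ]
  let f : K × ZMod 11 → St := fun p => ⟨τ p.2 * m p.1, (memSt _).2 (fromK p.1 p.2).1⟩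
  have hf : Function.Bijective f := by
    constructor
    · rintro ⟨k, b⟩ ⟨k', b'⟩ h
      have h' : τ b * m k = τ b' * m k' := congrArg Subtype.val h
      have e1 := (fromK k b).2
      have e2 := (fromK k' b').2
      rw [h'] at e1
      have a0 := (e1 0).symm.trans (e2 0)
      have a1 := (e1 1).symm.trans (e2 1)
      rw [OnePoint.coe_eq_coe] at a0 a1
      simp only [mul_zero, zero_add, mul_one] at a0 a1
      subst a0
      have : k = k' := Subtype.ext (Units.ext (add_right_cancel a1))
      rw [this]
    · rintro ⟨g, hg⟩
      rw [memSt] at hg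
      obtain ⟨k, b, h⟩ := toK g hg
      refine ⟨(k, b), Subtype.ext (hinj (aff_ext ?_ ?_))⟩
      · rw [hg]; exact (fromK k b).1
      · intro x
        rw [h]; exact (fromK k b).2 x
  have hcardSt : Nat.card St = Nat.card K * 11 := by
    rw [← Nat.card_congr (Equiv.ofBijective f hf), Nat.card_prod]
    simp
  have hcard : Nat.card G = 12 * (Nat.card K * 11) := by
    rw [← hcardSt, ← hidx, Subgroup.index_mul_card]
  have hun : Nat.card (ZMod 11)ˣ = 10 := by
    rw [Nat.card_eq_fintype_card, ZMod.card_units]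
  have hKd : Nat.card K ∣ 10 := by
    rw [← hun]; exact Subgroup.card_subgroup_dvd_card K
  have hK5 : Nat.card K = 5 ∨ Nat.card K = 10 := by
    have : Nat.card K ∈ Nat.divisors 10 := Nat.mem_divisors.2 ⟨hKd, by decide⟩
    have e : Nat.divisors 10 = {1, 2, 5, 10} := by decide
    rw [e] at this
    simp only [Finset.mem_insert, Finset.mem_singleton] at this
    omega
  have hK : Nat.card K = 5 := by
    rcases hK5 with h | h
    · exact h
    exfalso
    have htop : K = ⊤ := by
      apply Subgroup.eq_top_of_card_eq
      rw [h, hun]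
    have : (-1 : (ZMod 11)ˣ) ∈ K := by rw [htop]; trivial
    obtain ⟨g, hg, hg'⟩ := (memK _).1 this
    letI : Fintype Om := inferInstanceAs (Fintype (Option (ZMod 11)))
    letI : DecidableEq Om := inferInstanceAs (DecidableEq (Option (ZMod 11)))
    have hsg : Equiv.Perm.sign (φ g) = -1 := by
      have e : φ g = Equiv.optionCongr (Equiv.neg (ZMod 11)) := by
        apply aff_ext
        · exact hg
        · intro x
          rw [hg']
          simp
          rfl
      rw [e]
      refine (Equiv.optionCongr_sign (Equiv.neg (ZMod 11))).trans ?_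
      decide +kernel
    let ψ : G →* ℤˣ := (Equiv.Perm.sign).comp φ
    have hψ : ψ g = -1 := hsg
    rcases (inferInstance : ψ.ker.Normal).eq_bot_or_eq_top with h | h
    · have := Nat.card_le_card_of_injective ψ ((MonoidHom.ker_eq_bot_iff _).1 h)
      have h2 : Nat.card ℤˣ = 2 := by simp
      omega
    · have : g ∈ ψ.ker := by rw [h]; trivial
      rw [MonoidHom.mem_ker, hψ] at this
      exact absurd this (by decide)
  have hKpow : ∀ k : (ZMod 11)ˣ, k ∈ K → k ^ 5 = 1 := by
    intro k hk
    have : (⟨k, hk⟩ : K) ^ 5 = 1 := by rw [← hK]; exact pow_card_eq_one'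
    simpa using congrArg Subtype.val this
  have hKall : ∀ k : (ZMod 11)ˣ, k ^ 5 = 1 → k ∈ K := by
    have hsub : (Finset.univ.filter (fun k : (ZMod 11)ˣ => k ∈ K)) ⊆ Finset.univ.filter (fun k => k ^ 5 = 1) := by
      intro k hk
      simp only [Finset.mem_filter, Finset.mem_univ, true_and] at hk ⊢
      exact hKpow k hk
    have c1 : (Finset.univ.filter (fun k : (ZMod 11)ˣ => k ∈ K)).card = 5 := by
      rw [← hK, Nat.card_eq_fintype_card, Fintype.card_subtype]
    have c2 : (Finset.univ.filter (fun k : (ZMod 11)ˣ => k ^ 5 = 1)).card = 5 := by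
      decide +kernel
    have := Finset.eq_of_subset_of_card_le hsub (by rw [c1]; convert c2.le)
    intro k hk
    have hk2 : k ∈ Finset.univ.filter (fun k : (ZMod 11)ˣ => k ∈ K) := by
      rw [this]; simp [hk]
    simpa using hk2
  refine ⟨by rw [hcard, hK], ?_, ?_⟩
  · intro k hk b
    have hk0 : k ≠ 0 := by rintro rfl; exact absurd hk (by decide)
    have : Units.mk0 k hk0 ∈ K := hKall _ (Units.ext (by simpa using hk))
    exact ⟨_, fromK ⟨_, this⟩ b⟩
  · intro g hg
    obtain ⟨k, b, h⟩ := toK g hg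
    refine ⟨_, b, ?_, h⟩
    have := congrArg Units.val (hKpow _ k.2)
    simpa using this

theorem find_inv {G : Type*} [Group G] [Finite G] [IsSimpleGroup G]
    (φ : G →* Equiv.Perm Om) (hinj : Function.Injective φ)
    (htr : ∀ y, ∃ g, φ g OnePoint.infty = y) (h660 : Nat.card G = 660)
    (hB : ∀ k : ZMod 11, k ^ 5 = 1 → ∀ b : ZMod 11, ∃ g, φ g OnePoint.infty = OnePoint.infty ∧
        ∀ x : ZMod 11, φ g (x : Om) = ((k * x + b : ZMod 11) : Om))
    (hA : ∀ g, φ g OnePoint.infty = OnePoint.infty → ∃ k b : ZMod 11, k ^ 5 = 1 ∧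
        ∀ x : ZMod 11, φ g (x : Om) = ((k * x + b : ZMod 11) : Om)) :
    ∃ t : G, ∃ c : ZMod 11, c ^ 5 = -1 ∧ φ t OnePoint.infty = ((0 : ZMod 11) : Om) ∧
      φ t ((0 : ZMod 11) : Om) = OnePoint.infty ∧
      ∀ x : ZMod 11, x ≠ 0 → φ t (x : Om) = ((c * x⁻¹ : ZMod 11) : Om) := by
  have hA0 : ∀ g, φ g OnePoint.infty = OnePoint.infty → φ g ((0 : ZMod 11) : Om) = ((0 : ZMod 11) : Om) →
      ∃ k : ZMod 11, k ^ 5 = 1 ∧ ∀ x : ZMod 11, φ g (x : Om) = ((k * x : ZMod 11) : Om) := by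
    intro g hg h0
    obtain ⟨k, b, hk, h⟩ := hA g hg
    have h2 := h 0
    rw [h0, OnePoint.coe_eq_coe] at h2
    have hb : b = 0 := by simpa using h2.symm
    subst hb
    exact ⟨k, hk, fun x => by rw [h x, add_zero]⟩
  obtain ⟨t, ht2, hti, ht0⟩ : ∃ t : G, t * t = 1 ∧ φ t OnePoint.infty = ((0 : ZMod 11) : Om) ∧
      φ t ((0 : ZMod 11) : Om) = OnePoint.infty := by
    obtain ⟨g, hg⟩ := htr ((0 : ZMod 11) : Om)
    have : ∃ y : ZMod 11, φ g (y : Om) = OnePoint.infty := by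
      obtain ⟨y, hy⟩ := (φ g).surjective OnePoint.infty
      induction y using OnePoint.rec with
      | infty => rw [hg] at hy; exact absurd hy (OnePoint.coe_ne_infty _)
      | coe y => exact ⟨y, hy⟩
    obtain ⟨y, hy⟩ := this
    obtain ⟨s, hs, hs'⟩ := hB 1 (by simp) y
    have h1 : φ (g * s) OnePoint.infty = ((0 : ZMod 11) : Om) := by
      rw [map_mul, Equiv.Perm.mul_apply, hs, hg]
    have h2 : φ (g * s) ((0 : ZMod 11) : Om) = OnePoint.infty := by
      rw [map_mul, Equiv.Perm.mul_apply, hs', mul_zero, zero_add, hy]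
    generalize g * s = r at h1 h2
    have h3 : φ (r * r) OnePoint.infty = OnePoint.infty := by
      rw [map_mul, Equiv.Perm.mul_apply, h1, h2]
    have h4 : φ (r * r) ((0 : ZMod 11) : Om) = ((0 : ZMod 11) : Om) := by
      rw [map_mul, Equiv.Perm.mul_apply, h2, h1]
    obtain ⟨k, hk, hk'⟩ := hA0 _ h3 h4
    have h5 : ∀ n : ℕ, φ ((r * r) ^ n) OnePoint.infty = OnePoint.infty ∧
        ∀ x : ZMod 11, φ ((r * r) ^ n) (x : Om) = ((k ^ n * x : ZMod 11) : Om) := by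
      intro n
      induction n with
      | zero => simp
      | succ n ih =>
        constructor
        · rw [pow_succ, map_mul, Equiv.Perm.mul_apply, h3, ih.1]
        · intro x
          rw [pow_succ, map_mul, Equiv.Perm.mul_apply, hk', ih.2, pow_succ, mul_assoc]
    have h6 : (r * r) ^ 5 = 1 := by
      apply hinj
      apply aff_ext
      · rw [(h5 5).1]; simp
      · intro x; rw [(h5 5).2, hk]; simp
    refine ⟨r * (r * r) ^ 2, ?_, ?_, ?_⟩
    · rw [← h6]; simp only [pow_succ, pow_zero, one_mul, mul_assoc]
    · rw [map_mul, Equiv.Perm.mul_apply, (h5 2).1, h1]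
    · rw [map_mul, Equiv.Perm.mul_apply, (h5 2).2, mul_zero, h2]
  have htt : ∀ y, φ t (φ t y) = y := by
    intro y
    rw [← Equiv.Perm.mul_apply, ← map_mul, ht2]; simp
  have hnofix : ∀ y, φ t y ≠ y := by
    intro y hy
    obtain ⟨g, hg⟩ := htr y
    have e1 : φ (g⁻¹ * t * g) OnePoint.infty = OnePoint.infty := by
      rw [map_mul, map_mul, Equiv.Perm.mul_apply, Equiv.Perm.mul_apply, hg, hy, map_inv,
        Equiv.Perm.inv_eq_iff_eq, hg]
    have e2 : (g⁻¹ * t * g) * (g⁻¹ * t * g) = 1 := by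
      have : (g⁻¹ * t * g) * (g⁻¹ * t * g) = g⁻¹ * (t * t) * g := by group
      rw [this, ht2]; group
    obtain ⟨k, b, hk, h⟩ := hA _ e1
    have e3 : ∀ x : ZMod 11, k * (k * x + b) + b = x := by
      intro x
      rw [← OnePoint.coe_eq_coe, ← h, ← h, ← Equiv.Perm.mul_apply, ← map_mul, e2]; simp
    have e4 := e3 0
    have e5 := e3 1
    have e6 : k = 1 ∧ b = 0 := by
      clear h e3
      revert k b; decide +kernel
    have e7 : g⁻¹ * t * g = 1 := by
      apply hinj
      apply aff_ext
      · rw [e1]; simp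
      · intro x; rw [h, e6.1, e6.2]; simp
    have e8 : t = 1 := by
      have : t = g * (g⁻¹ * t * g) * g⁻¹ := by group
      rw [this, e7]; group
    rw [e8] at hti
    simp at hti
  -- t on nonzero elements
  have hf : ∀ x : ZMod 11, ∃ y : ZMod 11, x ≠ 0 → y ≠ 0 ∧ φ t (x : Om) = (y : Om) := by
    intro x
    by_cases hx : x = 0
    · exact ⟨0, fun h => absurd hx h⟩
    rcases hy : φ t (x : Om) with _ | y
    · exfalso
      have := htt (x : Om)
      change φ t (x : Om) = OnePoint.infty at hy
      rw [hy, hti, OnePoint.coe_eq_coe] at this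
      exact hx this.symm
    · refine ⟨y, fun _ => ⟨?_, rfl⟩⟩
      rintro rfl
      have := htt (x : Om)
      change φ t (x : Om) = ((0 : ZMod 11) : Om) at hy
      rw [hy, ht0] at this
      exact OnePoint.infty_ne_coe _ this
  choose f hf using hf
  have hff : ∀ x, x ≠ 0 → f (f x) = x := by
    intro x hx
    obtain ⟨h1, h2⟩ := hf x hx
    obtain ⟨h3, h4⟩ := hf (f x) h1
    rw [← OnePoint.coe_eq_coe, ← h4, ← h2, htt]
  have hfne : ∀ x, x ≠ 0 → f x ≠ x := by
    intro x hx h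
    apply hnofix (x : Om)
    rw [(hf x hx).2, h]
  obtain ⟨h, hhi, hh⟩ := hB 4 (by decide) 0
  simp only [add_zero] at hh
  have hinvt : t⁻¹ = t := inv_eq_of_mul_eq_one_left ht2
  obtain ⟨k, hk5, hk⟩ := hA0 (t * h * t) (by
      rw [map_mul, map_mul, Equiv.Perm.mul_apply, Equiv.Perm.mul_apply, hti, hh, mul_zero, ht0]) (by
      rw [map_mul, map_mul, Equiv.Perm.mul_apply, Equiv.Perm.mul_apply, ht0, hhi, hti])
  have hmul : ∀ x, x ≠ 0 → f (4 * x) = k * f x := by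
    intro x hx
    have h4 : (4 * x : ZMod 11) ≠ 0 := mul_ne_zero (by decide) hx
    rw [← OnePoint.coe_eq_coe, ← (hf _ h4).2, ← hk, map_mul, map_mul, Equiv.Perm.mul_apply,
      Equiv.Perm.mul_apply, ← (hf x hx).2, htt, hh]
  have hfnz : ∀ x, x ≠ 0 → f x ≠ 0 := fun x hx => (hf x hx).1
  have a4 : f 4 = k * f 1 := by simpa using hmul 1 (by decide)
  have a5 : f 5 = k * f 4 := hmul 4 (by decide)
  have a9 : f 9 = k * f 5 := hmul 5 (by decide)
  have a3 : f 3 = k * f 9 := hmul 9 (by decide)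
  have a1 : f 1 = k * f 3 := hmul 3 (by decide)
  have hfm : ∀ x, x ≠ 0 → f (k * x) = 4 * f x := by
    intro x hx
    have h1 := hmul (f x) (hfnz x hx)
    rw [hff x hx] at h1
    rw [← h1, hff]
    exact mul_ne_zero (by decide) (hfnz x hx)
  have b1 := hfm 1 (by decide)
  rw [mul_one] at b1
  have n1 := hfnz 1 (by decide)
  have hkc : k = 3 ∨ k = 4 := by
    have : k = 1 ∨ k = 3 ∨ k = 4 ∨ k = 5 ∨ k = 9 := by
      clear hk hmul a4 a5 a9 a3 a1 hfm b1
      revert k; decide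
    rcases this with rfl | rfl | rfl | rfl | rfl
    · exfalso
      generalize f 1 = z at b1 n1
      revert z; decide
    · left; rfl
    · right; rfl
    · exfalso
      rw [a5, a4] at b1
      generalize f 1 = z at b1 n1
      revert z; decide
    · exfalso
      rw [a9, a5, a4] at b1
      generalize f 1 = z at b1 n1
      revert z; decide
  rcases hkc with rfl | rfl
  · refine ⟨t, f 1, ?_, hti, ht0, ?_⟩
    · have g1 := hfne 1 (by decide)
      have g3 := hfne 3 (by decide)
      have g4 := hfne 4 (by decide)
      have g5 := hfne 5 (by decide)
      have g9 := hfne 9 (by decide)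
      rw [a3, a9, a5, a4] at g3
      rw [a9, a5, a4] at g9
      rw [a5, a4] at g5
      rw [a4] at g4
      have hc : f 1 = 2 ∨ f 1 = 6 ∨ f 1 = 7 ∨ f 1 = 8 ∨ f 1 = 10 := by
        generalize f 1 = z at g1 g3 g4 g5 g9 n1 ⊢
        clear * - g1 g3 g4 g5 g9 n1
        revert z; decide +kernel
      rcases hc with e | e | e | e | e <;> rw [e] <;> decide
    · intro x hx
      rw [(hf x hx).2, OnePoint.coe_eq_coe]
      rw [a9, a5, a4] at a3
      rw [a5, a4] at a9
      rw [a4] at a5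
      have i1 := hff 1 (by decide)
      have i3 := hff 3 (by decide)
      have i4 := hff 4 (by decide)
      have i5 := hff 5 (by decide)
      have i9 := hff 9 (by decide)
      have g1 := hfne 1 (by decide)
      have g3 := hfne 3 (by decide)
      have g4 := hfne 4 (by decide)
      have g5 := hfne 5 (by decide)
      have g9 := hfne 9 (by decide)
      rw [a3] at i3 g3
      rw [a4] at i4 g4
      rw [a5] at i5 g5
      rw [a9] at i9 g9
      have hc : f 1 = 2 ∨ f 1 = 6 ∨ f 1 = 7 ∨ f 1 = 8 ∨ f 1 = 10 := by
        generalize f 1 = z at g1 g3 g4 g5 g9 n1 ⊢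
        clear * - g1 g3 g4 g5 g9 n1
        revert z; decide +kernel
      have hxc : x = 1 ∨ x = 3 ∨ x = 4 ∨ x = 5 ∨ x = 9 ∨ x = f 1 ∨ x = 3 * f 1 ∨
          x = 3 * (3 * f 1) ∨ x = 3 * (3 * (3 * f 1)) ∨ x = 3 * (3 * (3 * (3 * f 1))) := by
        generalize f 1 = z at hc
        clear * - hc hx
        revert x z; decide +kernel
      rcases hxc with e | e | e | e | e | e | e | e | e | e
      · rw [e]; simp
      · rw [e, a3]; generalize f 1 = z; revert z; decide +kernel
      · rw [e, a4]; generalize f 1 = z; revert z; decide +kernel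
      · rw [e, a5]; generalize f 1 = z; revert z; decide +kernel
      · rw [e, a9]; generalize f 1 = z; revert z; decide +kernel
      · rw [e, i1]; clear * - n1; generalize f 1 = z at n1 ⊢; revert z; decide +kernel
      · rw [e, i4]; clear * - n1; generalize f 1 = z at n1 ⊢; revert z; decide +kernel
      · rw [e, i5]; clear * - n1; generalize f 1 = z at n1 ⊢; revert z; decide +kernel
      · rw [e, i9]; clear * - n1; generalize f 1 = z at n1 ⊢; revert z; decide +kernel
      · rw [e, i3]; clear * - n1; generalize f 1 = z at n1 ⊢; revert z; decide +kernel
  · exfalso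
    have hcomm : t * h * t = h := by
      apply hinj
      apply aff_ext
      · rw [hhi, map_mul, map_mul, Equiv.Perm.mul_apply, Equiv.Perm.mul_apply, hti, hh, mul_zero, ht0]
      · intro x; rw [hk, hh]
    have hth : Commute t h := by
      change t * h = h * t
      calc t * h = t * h * (t * t) := by rw [ht2, mul_one]
        _ = (t * h * t) * t := by group
        _ = h * t := by rw [hcomm]
    have hpw : ∀ n : ℕ, φ (h ^ n) OnePoint.infty = OnePoint.infty ∧
        ∀ x : ZMod 11, φ (h ^ n) (x : Om) = ((4 ^ n * x : ZMod 11) : Om) := by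
      intro n
      induction n with
      | zero => simp
      | succ n ih =>
        constructor
        · rw [pow_succ, map_mul, Equiv.Perm.mul_apply, hhi, ih.1]
        · intro x
          rw [pow_succ, map_mul, Equiv.Perm.mul_apply, hh, ih.2, pow_succ, mul_assoc]
    have h5 : h ^ 5 = 1 := by
      apply hinj
      apply aff_ext
      · rw [(hpw 5).1]; simp
      · intro x; rw [(hpw 5).2, show (4 ^ 5 : ZMod 11) = 1 by decide]; simp
    have hne1 : h ≠ 1 := by
      rintro rfl
      have := hh 1
      simp only [map_one, Equiv.Perm.one_apply, OnePoint.coe_eq_coe] at this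
      exact absurd this (by decide)
    have : Fact (Nat.Prime 5) := ⟨by norm_num⟩
    have ho : orderOf h = 5 := orderOf_eq_prime h5 hne1
    have hfac : (660 : ℕ).factorization 5 = 1 := by
      rw [show 660 = 5 * 132 by norm_num, Nat.factorization_mul (by norm_num) (by norm_num)]
      rw [Finsupp.add_apply, Nat.Prime.factorization_self (by norm_num),
        Nat.factorization_eq_zero_of_not_dvd (by norm_num)]
    let P : Sylow 5 G := Sylow.ofCard (Subgroup.zpowers h) (by
      rw [Nat.card_zpowers, ho, h660, hfac, pow_one])
    have hPz : (P : Subgroup G) = Subgroup.zpowers h := rfl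
    have hPs : (P : Set G) = (Subgroup.zpowers h : Set G) := rfl
    have key : ∀ g, φ g OnePoint.infty = OnePoint.infty → φ g ((0 : ZMod 11) : Om) = ((0 : ZMod 11) : Om) →
        Commute g h := by
      intro g h1 h2
      obtain ⟨q, _, hq⟩ := hA0 g h1 h2
      apply hinj
      apply aff_ext
      · rw [map_mul, map_mul, Equiv.Perm.mul_apply, Equiv.Perm.mul_apply, hhi, h1, hhi]
      · intro x
        rw [map_mul, map_mul, Equiv.Perm.mul_apply, Equiv.Perm.mul_apply, hh, hq, hq, hh]
        congr 1; ring
    have hfixz : ∀ z ∈ Subgroup.zpowers h, φ z OnePoint.infty = OnePoint.infty ∧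
        φ z ((0 : ZMod 11) : Om) = ((0 : ZMod 11) : Om) := by
      intro z hz
      rw [← (isOfFinOrder_of_finite h).mem_powers_iff_mem_zpowers] at hz
      obtain ⟨n, rfl⟩ := hz
      exact ⟨(hpw n).1, by rw [(hpw n).2, mul_zero]⟩
    have hfixh : ∀ y, φ h y = y → y = OnePoint.infty ∨ y = ((0 : ZMod 11) : Om) := by
      intro y hy
      induction y using OnePoint.rec with
      | infty => left; rfl
      | coe y =>
        right
        rw [hh, OnePoint.coe_eq_coe] at hy
        rw [OnePoint.coe_eq_coe]
        clear * - hy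
        revert y; decide
    have hNC : Subgroup.normalizer (P : Set G) ≤ Subgroup.centralizer (P : Set G) := by
      intro n hn
      have hnz : n * h * n⁻¹ ∈ Subgroup.zpowers h :=
        (Subgroup.mem_normalizer_iff.1 hn h).1 (Subgroup.mem_zpowers h)
      obtain ⟨z1, z2⟩ := hfixz _ hnz
      have c1 : Commute n h := by
        rw [← Commute.inv_left_iff]
        have w : ∀ y, φ (n * h * n⁻¹) y = y → φ h (φ n⁻¹ y) = φ n⁻¹ y := by
          intro y hy
          rw [map_mul, map_mul, Equiv.Perm.mul_apply, Equiv.Perm.mul_apply] at hy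
          conv_rhs => rw [← hy]
          rw [← Equiv.Perm.mul_apply (φ n⁻¹), ← map_mul]
          simp
        have w1 := hfixh _ (w _ z1)
        have w2 := hfixh _ (w _ z2)
        have w3 : φ n⁻¹ OnePoint.infty ≠ φ n⁻¹ ((0 : ZMod 11) : Om) := by
          intro hc
          exact OnePoint.infty_ne_coe _ ((φ n⁻¹).injective hc)
        rcases w1 with w1 | w1
        · rcases w2 with w2 | w2
          · exact absurd (w1.trans w2.symm) w3
          · exact key _ w1 w2
        · rcases w2 with w2 | w2
          · have := key (t * n⁻¹) (by rw [map_mul, Equiv.Perm.mul_apply, w1, ht0])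
              (by rw [map_mul, Equiv.Perm.mul_apply, w2, hti])
            have h9 := hth.mul_left this
            rwa [← mul_assoc, ht2, one_mul] at h9
          · exact absurd (w1.trans w2.symm) w3
      rw [Subgroup.mem_centralizer_iff]
      intro z hz
      obtain ⟨i, rfl⟩ : z ∈ Subgroup.zpowers h := hz
      exact (c1.zpow_right i).symm.eq
    have hcompl := MonoidHom.ker_transferSylow_isComplement' P hNC
    have hcm := hcompl.card_mul_card
    have hPc : Nat.card (P : Subgroup G) = 5 := by rw [hPz, Nat.card_zpowers, ho]
    rw [hPc, h660] at hcm
    rcases (inferInstance : (MonoidHom.transferSylow P hNC).ker.Normal).eq_bot_or_eq_top with h | h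
    · rw [h, Subgroup.card_bot] at hcm
      omega
    · rw [h, Subgroup.card_top, h660] at hcm
      omega

theorem alg_one {F : Type*} [Field F] {c a b u d x : F} (hc : c ≠ 0) (hu : u ≠ 0)
    (hq : u * x + d ≠ 0) (hd : a * d - b * u = 1) :
    1 * (c * ((-c * u) * (u * x + d))⁻¹) + a / u = (a * x + b) / (u * x + d) := by
  rw [eq_div_iff hq]
  obtain ⟨q, hq'⟩ : ∃ q, q = u * x + d := ⟨_, rfl⟩
  rw [← hq'] at hq ⊢
  field_simp
  linear_combination a * hq' + hd

theorem alg_two {F : Type*} [Field F] {k b x : F} (hk0 : k ≠ 0) (hk : k ^ 5 = 1) :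
    (k ^ 3 * x + b / k ^ 3) / (0 * x + (k ^ 3)⁻¹) = k * x + b := by
  rw [zero_mul, zero_add, div_inv_eq_mul, add_mul, div_mul_cancel₀ _ (pow_ne_zero 3 hk0)]
  linear_combination k * x * hk

theorem psl_of_perm {G : Type*} [Group G]
    (φ : G →* Equiv.Perm Om) (hinj : Function.Injective φ)
    (hB : ∀ k : ZMod 11, k ^ 5 = 1 → ∀ b : ZMod 11, ∃ g, φ g OnePoint.infty = OnePoint.infty ∧
        ∀ x : ZMod 11, φ g (x : Om) = ((k * x + b : ZMod 11) : Om))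
    (hA : ∀ g, φ g OnePoint.infty = OnePoint.infty → ∃ k b : ZMod 11, k ^ 5 = 1 ∧
        ∀ x : ZMod 11, φ g (x : Om) = ((k * x + b : ZMod 11) : Om))
    (t : G) (c : ZMod 11) (hc5 : c ^ 5 = -1) (hti : φ t OnePoint.infty = ((0 : ZMod 11) : Om))
    (ht0 : φ t ((0 : ZMod 11) : Om) = OnePoint.infty)
    (ht : ∀ x : ZMod 11, x ≠ 0 → φ t (x : Om) = ((c * x⁻¹ : ZMod 11) : Om)) :
    Nonempty (G ≃* PSL(2, ZMod 11)) := by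
  let ρ : SL(2, ZMod 11) →* Equiv.Perm Om :=
    (MulAction.toPermHom (GL (Fin 2) (ZMod 11)) Om).comp Matrix.SpecialLinearGroup.toGL
  have ρi : ∀ A : SL(2, ZMod 11), ρ A OnePoint.infty =
      if A 1 0 = 0 then OnePoint.infty else ((A 0 0 / A 1 0 : ZMod 11) : Om) := by
    intro A
    exact OnePoint.smul_infty_eq_ite _
  have ρc : ∀ (A : SL(2, ZMod 11)) (x : ZMod 11), ρ A (x : Om) =
      if A 1 0 * x + A 1 1 = 0 then OnePoint.infty else
        (((A 0 0 * x + A 0 1) / (A 1 0 * x + A 1 1) : ZMod 11) : Om) := by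
    intro A x
    exact OnePoint.smul_some_eq_ite
  have hdet : ∀ A : SL(2, ZMod 11), A 0 0 * A 1 1 - A 0 1 * A 1 0 = 1 := by
    intro A
    have := A.2
    rwa [Matrix.det_fin_two] at this
  have hker : ρ.ker = Subgroup.center (SL(2, ZMod 11)) := by
    ext A
    rw [MonoidHom.mem_ker, Matrix.SpecialLinearGroup.mem_center_iff]
    have hd := hdet A
    constructor
    · intro h
      have hi := ρi A
      have h0 := ρc A 0
      have h1 := ρc A 1
      rw [h, Equiv.Perm.one_apply] at hi h0 h1
      have c0 : A 1 0 = 0 := by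
        by_contra hne
        rw [if_neg hne] at hi
        exact OnePoint.infty_ne_coe _ hi
      rw [c0] at hd h0 h1
      simp only [mul_zero, zero_add, mul_one, sub_zero] at hd h0 h1
      have d0 : A 1 1 ≠ 0 := by
        intro hz; rw [hz, mul_zero] at hd; exact absurd hd (by decide)
      rw [if_neg d0, OnePoint.coe_eq_coe, eq_div_iff d0, zero_mul] at h0
      rw [if_neg d0, OnePoint.coe_eq_coe, eq_div_iff d0, ← h0, one_mul, add_zero] at h1
      refine ⟨A 0 0, ?_, ?_⟩
      · rw [Fintype.card_fin, pow_two]; rw [h1] at hd; exact hd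
      · ext i j
        fin_cases i <;> fin_cases j <;> simp [c0, ← h0, h1]
    · rintro ⟨r, hr, hA'⟩
      have e00 : A 0 0 = r := by rw [← hA']; simp
      have e11 : A 1 1 = r := by rw [← hA']; simp
      have e01 : A 0 1 = 0 := by rw [← hA']; simp
      have e10 : A 1 0 = 0 := by rw [← hA']; simp
      have r0 : r ≠ 0 := by
        rintro rfl
        rw [e00, e01] at hd
        simp at hd
      apply aff_ext
      · rw [ρi, if_pos e10]; rfl
      · intro x
        rw [ρc, e00, e11, e01, e10]
        simp [r0]
  have hST : ∀ A, ρ A ∈ φ.range := by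
    intro A
    have hd := hdet A
    by_cases h0 : A 1 0 = 0
    · rw [h0, mul_zero, sub_zero] at hd
      have ha : A 0 0 ≠ 0 := by
        intro hz; rw [hz, zero_mul] at hd; exact absurd hd (by decide)
      obtain ⟨g, hg, hg'⟩ := hB (A 0 0 ^ 2) (by
        rw [← pow_mul]; exact ZMod.pow_card_sub_one_eq_one ha) (A 0 0 * A 0 1)
      refine ⟨g, aff_ext ?_ ?_⟩
      · rw [hg, ρi, if_pos h0]
      · intro x
        have hd0 : A 1 1 ≠ 0 := by
          intro hz; rw [hz, mul_zero] at hd; exact absurd hd (by decide)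
        rw [hg', ρc, h0, zero_mul, zero_add, if_neg hd0, OnePoint.coe_eq_coe, eq_div_iff hd0]
        linear_combination (A 0 0 * x + A 0 1) * hd
    · have hc0 : c ≠ 0 := by rintro rfl; exact absurd hc5 (by decide)
      obtain ⟨g1, hg1, hg1'⟩ := hB 1 (by simp) (A 0 0 / A 1 0)
      obtain ⟨g2, hg2, hg2'⟩ := hB (-c * A 1 0 ^ 2) (by
        have : A 1 0 ^ 10 = 1 := ZMod.pow_card_sub_one_eq_one h0
        have e : (-c * A 1 0 ^ 2) ^ 5 = - c ^ 5 * A 1 0 ^ 10 := by ring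
        rw [e, hc5, this]; ring) (-c * A 1 0 * A 1 1)
      refine ⟨g1 * t * g2, aff_ext ?_ ?_⟩
      · rw [map_mul, map_mul, Equiv.Perm.mul_apply, Equiv.Perm.mul_apply, hg2, hti, hg1', ρi, if_neg h0]
        simp
      · intro x
        rw [map_mul, map_mul, Equiv.Perm.mul_apply, Equiv.Perm.mul_apply, hg2', ρc]
        have e : -c * A 1 0 ^ 2 * x + -c * A 1 0 * A 1 1 = (-c * A 1 0) * (A 1 0 * x + A 1 1) := by ring
        rw [e]
        by_cases hp : A 1 0 * x + A 1 1 = 0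
        · rw [hp, if_pos rfl, mul_zero, ht0, hg1]
        · rw [if_neg hp, ht _ (mul_ne_zero (mul_ne_zero (neg_ne_zero.2 hc0) h0) hp), hg1', OnePoint.coe_eq_coe]
          exact alg_one hc0 h0 hp hd
  have hTS : ∀ g, φ g ∈ ρ.range := by
    have base : ∀ g, φ g OnePoint.infty = OnePoint.infty → φ g ∈ ρ.range := by
      intro g hg
      obtain ⟨k, b, hk, h⟩ := hA g hg
      have hk0 : k ≠ 0 := by rintro rfl; exact absurd hk (by decide)
      have hdetM : Matrix.det !![k ^ 3, b / k ^ 3; 0, (k ^ 3)⁻¹] = 1 := by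
        rw [Matrix.det_fin_two_of, mul_zero, sub_zero, mul_inv_cancel₀ (pow_ne_zero 3 hk0)]
      let M : SL(2, ZMod 11) := ⟨_, hdetM⟩
      refine ⟨M, aff_ext ?_ ?_⟩
      · rw [ρi, hg]; simp [M]
      · intro x
        rw [ρc, h]
        have hne : (0 : ZMod 11) * x + (k ^ 3)⁻¹ ≠ 0 := by
          rw [zero_mul, zero_add]; exact inv_ne_zero (pow_ne_zero 3 hk0)
        refine (if_neg hne).trans ?_
        rw [OnePoint.coe_eq_coe]
        exact alg_two hk0 hk
    intro g
    rcases hy : φ g OnePoint.infty with _ | y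
    · exact base g hy
    · change φ g OnePoint.infty = (y : Om) at hy
      let A : SL(2, ZMod 11) := ⟨!![y, -1; 1, 0], by rw [Matrix.det_fin_two_of]; ring⟩
      have hAi : ρ A OnePoint.infty = (y : Om) := by
        rw [ρi]; simp [A]
      obtain ⟨s, hs⟩ := hST A
      have := base (s⁻¹ * g) (by
        rw [map_mul, Equiv.Perm.mul_apply, hy, map_inv, Equiv.Perm.inv_eq_iff_eq, hs, hAi])
      have h2 := ρ.range.mul_mem ⟨A, rfl⟩ this
      rw [← hs, ← map_mul, mul_inv_cancel_left] at h2
      exact h2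
  have hrange : φ.range = ρ.range := by
    apply le_antisymm
    · rintro _ ⟨g, rfl⟩; exact hTS g
    · rintro _ ⟨A, rfl⟩; exact hST A
  exact ⟨(MonoidHom.ofInjective hinj).trans ((MulEquiv.subgroupCongr hrange).trans
    ((QuotientGroup.quotientKerEquivRange ρ).symm.trans (QuotientGroup.quotientMulEquivOfEq hker)))⟩

theorem stmt_19 (G : Type*) [Group G] [Finite G] [IsSimpleGroup G]
    (hna : ¬ ∀ a b : G, a * b = b * a)
    (hU : sameSizeSet G = {1, 55, 120, 220, 264}) :
    Nonempty (G ≃* PSL(2, ZMod 11)) := by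
  obtain ⟨⟨h11, h121, h660⟩, hc⟩ := card_facts hU
  obtain ⟨P⟩ : Nonempty (Sylow 11 G) := inferInstance
  obtain ⟨h12, σ, ho, hz⟩ := sylow_twelve h11 h121 h660 hc P
  obtain ⟨φ, hinj, htr, hT, hA⟩ := embed P h12 σ ho hz
  obtain ⟨hcard, hB, hA'⟩ := card_stuff φ hinj htr hT hA h660
  obtain ⟨t, c, hc5, hti, ht0, ht⟩ := find_inv φ hinj htr hcard hB hA'
  exact psl_of_perm φ hinj hB hA' t c hc5 hti ht0 ht
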